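/- For λ > 0 let (u_λ, v_λ) be the unique solution of the system λu + f(u − v) = 0, λv + g(v − u) = 0. Then lim_{λ→0+}(u_λ − v_λ) = d, and with μ_j = k₂ 2^{−j}/(d − 2^{−j}) and ν_j = 2^{−j}|y*|/(d − 2^{−j}|x*|), one has lim_{j→∞} v_{μ_j} = k₀d/k₂ − d and lim_{j→∞} v_{ν_j} = k₀d/k* − d. -/

import Mathlib

open Real Filter Set

/-- x-coordinate of the intersection of the lines y = k*x and y = -k₂/2 + k₁(x+1/2). -/
noncomputable def xstar (k1 k2 ks : ℝ) : ℝ := (k1 - k2) / (2 * (ks - k1))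

/-- y-coordinate: y* = k* x*. -/
noncomputable def ystar (k1 k2 ks : ℝ) : ℝ := ks * xstar k1 k2 ks

/-- The slope k⁺ = (y* + k₂)/(x* + 1). -/
noncomputable def kplus (k1 k2 ks : ℝ) : ℝ :=
  (ystar k1 k2 ks + k2) / (xstar k1 k2 ks + 1)

/-- The function ψ: equal to k₂x outside (-1, -1/2), and the min of the two lines inside. -/
noncomputable def psi (k1 k2 ks : ℝ) (x : ℝ) : ℝ :=
  if x ∈ Set.Ioo (-1 : ℝ) (-(1 / 2) : ℝ) then
    min (-k2 + kplus k1 k2 ks * (x + 1)) (-k2 / 2 + k1 * (x + 1 / 2))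
  else k2 * x

/-- The rescaled functions ψ_j(x) = 2^(-j) ψ(2^j x). -/
noncomputable def psij (k1 k2 ks : ℝ) (j : ℕ) (x : ℝ) : ℝ :=
  (2 : ℝ) ^ (-(j : ℤ)) * psi k1 k2 ks ((2 : ℝ) ^ j * x)

/-- η(x) = sup_{j ≥ 1} ψ_j(x). -/
noncomputable def eta (k1 k2 ks : ℝ) (x : ℝ) : ℝ :=
  ⨆ j : {j : ℕ // 1 ≤ j}, psij k1 k2 ks j x

/-- h(x) = η(x - d). -/
noncomputable def hfun (k1 k2 ks d : ℝ) (x : ℝ) : ℝ := eta k1 k2 ks (x - d)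

/-- f(x) = k₀ (x - d). -/
noncomputable def ffun (k0 d : ℝ) (x : ℝ) : ℝ := k0 * (x - d)

/-- g(x) = f(-x) - h(-x). -/
noncomputable def gfun (k0 k1 k2 ks d : ℝ) (x : ℝ) : ℝ :=
  ffun k0 d (-x) - hfun k1 k2 ks d (-x)

section PsiEta

variable {k1 k2 ks : ℝ}

lemma xstar_mem_Ioo (hk12 : k1 < k2) (hks1 : (k1 + k2) / 2 < ks) (hks2 : ks < k2) :
    xstar k1 k2 ks ∈ Set.Ioo (-1 : ℝ) (-(1 / 2) : ℝ) := by
  have h : 0 < 2 * (ks - k1) := by linarith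
  unfold xstar
  rw [Set.mem_Ioo, lt_div_iff₀ h, div_lt_iff₀ h]
  constructor <;> linarith

lemma ystar_eq (hk12 : k1 < k2) (hks1 : (k1 + k2) / 2 < ks) :
    ystar k1 k2 ks = -k2 / 2 + k1 * (xstar k1 k2 ks + 1 / 2) := by
  have h : ks - k1 ≠ 0 := by linarith
  unfold ystar xstar
  field_simp
  ring

lemma kplus_mul (hk12 : k1 < k2) (hks1 : (k1 + k2) / 2 < ks) (hks2 : ks < k2) :
    kplus k1 k2 ks * (xstar k1 k2 ks + 1) = ystar k1 k2 ks + k2 := by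
  have h := (xstar_mem_Ioo hk12 hks1 hks2).1
  unfold kplus
  exact div_mul_cancel₀ _ (by linarith)

lemma lt_kplus (hk12 : k1 < k2) (hks1 : (k1 + k2) / 2 < ks) (hks2 : ks < k2) :
    k2 < kplus k1 k2 ks := by
  have h := xstar_mem_Ioo hk12 hks1 hks2
  have h1 : 0 < xstar k1 k2 ks + 1 := by linarith [h.1]
  unfold kplus ystar
  rw [lt_div_iff₀ h1]
  nlinarith [h.2]

lemma psi_eq_max (hk12 : k1 < k2) (hks1 : (k1 + k2) / 2 < ks) (hks2 : ks < k2) (x : ℝ) :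
    psi k1 k2 ks x = max (k2 * x)
      (min (-k2 + kplus k1 k2 ks * (x + 1)) (-k2 / 2 + k1 * (x + 1 / 2))) := by
  have hk := lt_kplus hk12 hks1 hks2
  unfold psi
  split_ifs with h
  · refine (max_eq_right (le_min ?_ ?_)).symm
    · nlinarith [h.1]
    · nlinarith [h.2]
  · refine (max_eq_left ?_).symm
    rcases le_or_gt x (-1) with h1 | h1
    · refine (min_le_left _ _).trans ?_
      nlinarith
    · have h2 : -(1 / 2) ≤ x := not_lt.mp fun h2 => h ⟨h1, h2⟩
      refine (min_le_right _ _).trans ?_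
      nlinarith

lemma psi_monotone (hk1 : 0 < k1) (hk12 : k1 < k2) (hks1 : (k1 + k2) / 2 < ks)
    (hks2 : ks < k2) : Monotone (psi k1 k2 ks) := by
  intro x y hxy
  have hk := lt_kplus hk12 hks1 hks2
  have hk2 : 0 < k2 := hk1.trans hk12
  have hp : 0 < kplus k1 k2 ks := hk2.trans hk
  rw [psi_eq_max hk12 hks1 hks2, psi_eq_max hk12 hks1 hks2]
  gcongr

lemma le_psi (hk12 : k1 < k2) (hks1 : (k1 + k2) / 2 < ks) (hks2 : ks < k2) (x : ℝ) :
    k2 * x ≤ psi k1 k2 ks x := by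
  rw [psi_eq_max hk12 hks1 hks2]
  exact le_max_left _ _

lemma psi_le_max (hk12 : k1 < k2) (hks1 : (k1 + k2) / 2 < ks) (hks2 : ks < k2) (x : ℝ) :
    psi k1 k2 ks x ≤ max (k2 * x) (ks * x) := by
  have hk := lt_kplus hk12 hks1 hks2
  have hy := ystar_eq hk12 hks1
  have hm := kplus_mul hk12 hks1 hks2
  have hys : ystar k1 k2 ks = ks * xstar k1 k2 ks := rfl
  rw [psi_eq_max hk12 hks1 hks2]
  refine max_le_max le_rfl ?_
  rcases le_total x (xstar k1 k2 ks) with h | h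
  · refine (min_le_left _ _).trans ?_
    nlinarith
  · refine (min_le_right _ _).trans ?_
    nlinarith

lemma psi_xstar (hk12 : k1 < k2) (hks1 : (k1 + k2) / 2 < ks) (hks2 : ks < k2) :
    psi k1 k2 ks (xstar k1 k2 ks) = ystar k1 k2 ks := by
  rw [psi, if_pos (xstar_mem_Ioo hk12 hks1 hks2), kplus_mul hk12 hks1 hks2,
    ← ystar_eq hk12 hks1]
  simp

lemma two_zpow_neg_mul_pow_mul (j : ℕ) (a : ℝ) :
    (2 : ℝ) ^ (-(j : ℤ)) * ((2 : ℝ) ^ j * a) = a := by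
  rw [zpow_neg, zpow_natCast]
  field_simp

lemma psij_monotone (hk1 : 0 < k1) (hk12 : k1 < k2) (hks1 : (k1 + k2) / 2 < ks)
    (hks2 : ks < k2) (j : ℕ) : Monotone (psij k1 k2 ks j) := by
  intro x y hxy
  exact mul_le_mul_of_nonneg_left
    (psi_monotone hk1 hk12 hks1 hks2 (mul_le_mul_of_nonneg_left hxy (by positivity)))
    (by positivity)

lemma le_psij (hk12 : k1 < k2) (hks1 : (k1 + k2) / 2 < ks) (hks2 : ks < k2) (j : ℕ) (x : ℝ) :
    k2 * x ≤ psij k1 k2 ks j x := by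
  calc k2 * x = (2 : ℝ) ^ (-(j : ℤ)) * (k2 * ((2 : ℝ) ^ j * x)) := by
        rw [mul_left_comm, two_zpow_neg_mul_pow_mul]
    _ ≤ _ := mul_le_mul_of_nonneg_left (le_psi hk12 hks1 hks2 _) (by positivity)

lemma psij_le_max (hk12 : k1 < k2) (hks1 : (k1 + k2) / 2 < ks) (hks2 : ks < k2)
    (j : ℕ) (x : ℝ) : psij k1 k2 ks j x ≤ max (k2 * x) (ks * x) := by
  have hp : (0 : ℝ) ≤ (2 : ℝ) ^ (-(j : ℤ)) := by positivity
  calc psij k1 k2 ks j x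
      ≤ (2 : ℝ) ^ (-(j : ℤ)) * max (k2 * ((2 : ℝ) ^ j * x)) (ks * ((2 : ℝ) ^ j * x)) :=
        mul_le_mul_of_nonneg_left (psi_le_max hk12 hks1 hks2 _) hp
    _ = _ := by
        rw [mul_max_of_nonneg _ _ hp, mul_left_comm, two_zpow_neg_mul_pow_mul,
          mul_left_comm, two_zpow_neg_mul_pow_mul]

lemma bddAbove_range_psij (hk12 : k1 < k2) (hks1 : (k1 + k2) / 2 < ks) (hks2 : ks < k2)
    (x : ℝ) : BddAbove (Set.range fun j : {j : ℕ // 1 ≤ j} => psij k1 k2 ks j x) :=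
  ⟨max (k2 * x) (ks * x), by rintro _ ⟨j, rfl⟩; exact psij_le_max hk12 hks1 hks2 _ _⟩

lemma psij_le_eta (hk12 : k1 < k2) (hks1 : (k1 + k2) / 2 < ks) (hks2 : ks < k2)
    {j : ℕ} (hj : 1 ≤ j) (x : ℝ) : psij k1 k2 ks j x ≤ eta k1 k2 ks x :=
  le_ciSup (bddAbove_range_psij hk12 hks1 hks2 x) (⟨j, hj⟩ : {j : ℕ // 1 ≤ j})

lemma eta_le {x a : ℝ} (h : ∀ j : ℕ, 1 ≤ j → psij k1 k2 ks j x ≤ a) :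
    eta k1 k2 ks x ≤ a :=
  haveI : Nonempty {j : ℕ // 1 ≤ j} := ⟨⟨1, le_rfl⟩⟩
  ciSup_le fun j => h j j.2

lemma eta_monotone (hk1 : 0 < k1) (hk12 : k1 < k2) (hks1 : (k1 + k2) / 2 < ks)
    (hks2 : ks < k2) : Monotone (eta k1 k2 ks) := fun _ y hxy =>
  eta_le fun j hj =>
    (psij_monotone hk1 hk12 hks1 hks2 j hxy).trans (psij_le_eta hk12 hks1 hks2 hj y)

lemma le_eta (hk12 : k1 < k2) (hks1 : (k1 + k2) / 2 < ks) (hks2 : ks < k2) (x : ℝ) :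
    k2 * x ≤ eta k1 k2 ks x :=
  (le_psij hk12 hks1 hks2 1 x).trans (psij_le_eta hk12 hks1 hks2 le_rfl x)

lemma eta_le_of_nonpos (hk12 : k1 < k2) (hks1 : (k1 + k2) / 2 < ks) (hks2 : ks < k2)
    {x : ℝ} (hx : x ≤ 0) : eta k1 k2 ks x ≤ ks * x :=
  eta_le fun j _ => (psij_le_max hk12 hks1 hks2 j x).trans (max_le (by nlinarith) le_rfl)

lemma eta_neg_two_zpow (hk12 : k1 < k2) (hks1 : (k1 + k2) / 2 < ks) (hks2 : ks < k2) (j : ℕ) :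
    eta k1 k2 ks (-(2 : ℝ) ^ (-(j : ℤ))) = -(k2 * (2 : ℝ) ^ (-(j : ℤ))) := by
  rw [← mul_neg]
  refine le_antisymm (eta_le fun i _ => ?_) (le_eta hk12 hks1 hks2 _)
  have hn : (2 : ℝ) ^ i * -(2 : ℝ) ^ (-(j : ℤ)) ∉ Set.Ioo (-1 : ℝ) (-(1 / 2) : ℝ) := by
    rw [zpow_neg, zpow_natCast, mul_neg, ← div_eq_mul_inv]
    have hp : (0 : ℝ) < 2 ^ j := by positivity
    rintro ⟨h1, h2⟩
    rw [neg_lt_neg_iff] at h1 h2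
    rw [div_lt_one hp] at h1
    rw [lt_div_iff₀ hp] at h2
    have hij : i < j := (pow_lt_pow_iff_right₀ (by norm_num : (1 : ℝ) < 2)).mp h1
    have := pow_le_pow_right₀ (by norm_num : (1 : ℝ) ≤ 2) (Nat.succ_le_of_lt hij)
    rw [pow_succ] at this
    linarith
  rw [psij, psi, if_neg hn, mul_left_comm, two_zpow_neg_mul_pow_mul]

lemma eta_two_zpow_mul_xstar (hk12 : k1 < k2) (hks1 : (k1 + k2) / 2 < ks) (hks2 : ks < k2)
    {j : ℕ} (hj : 1 ≤ j) :
    eta k1 k2 ks ((2 : ℝ) ^ (-(j : ℤ)) * xstar k1 k2 ks) =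
      ks * ((2 : ℝ) ^ (-(j : ℤ)) * xstar k1 k2 ks) := by
  have hx := xstar_mem_Ioo hk12 hks1 hks2
  refine le_antisymm (eta_le_of_nonpos hk12 hks1 hks2
    (mul_nonpos_of_nonneg_of_nonpos (by positivity) (by linarith [hx.2]))) ?_
  refine le_trans (le_of_eq ?_) (psij_le_eta hk12 hks1 hks2 hj _)
  rw [psij, mul_left_comm ((2 : ℝ) ^ j), two_zpow_neg_mul_pow_mul, psi_xstar hk12 hks1 hks2,
    ystar, mul_left_comm]

/-- Strict monotonicity of `t ↦ l * t + η t` identifies the solution of the resolvent equation. -/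
lemma eq_of_resolvent (hk1 : 0 < k1) (hk12 : k1 < k2) (hks1 : (k1 + k2) / 2 < ks)
    (hks2 : ks < k2) {l d s t : ℝ} (hl : 0 < l)
    (hs : l * (s + d) + eta k1 k2 ks s = 0) (ht : l * (t + d) + eta k1 k2 ks t = 0) :
    s = t := by
  have hm := eta_monotone hk1 hk12 hks1 hks2
  rcases lt_trichotomy s t with h | h | h
  · have := hm h.le
    nlinarith
  · exact h
  · have := hm h.le
    nlinarith

lemma resolvent_component_eq (hk1 : 0 < k1) (hk12 : k1 < k2) (hks1 : (k1 + k2) / 2 < ks)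
    (hks2 : ks < k2) {l d k0 t b K r : ℝ} (hK : 0 < K) (hr : 0 < r) (hrd : r < d)
    (hl : l = K * r / (d - r)) (hη : eta k1 k2 ks (-r) = -(K * r))
    (ht : l * (t + d) + eta k1 k2 ks t = 0)
    (hb : l * b + k0 * t + l * (t + d) = 0) :
    b = k0 * (d - r) / K - (d - r) := by
  have hdr : 0 < d - r := by linarith
  have hl0 : 0 < l := by rw [hl]; positivity
  have hlr : l * (d - r) = K * r := by rw [hl]; field_simp
  have htr : t = -r := eq_of_resolvent hk1 hk12 hks1 hks2 hl0 ht (by rw [hη]; linarith)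
  subst htr
  refine mul_left_cancel₀ hl0.ne' ?_
  have h2 : l * (k0 * (d - r) / K) = k0 * r := by
    calc l * (k0 * (d - r) / K) = k0 * (l * (d - r)) / K := by ring
      _ = k0 * r := by rw [hlr]; field_simp
  rw [mul_sub, h2]
  linarith

end PsiEta

lemma tendsto_two_zpow_neg :
    Tendsto (fun j : ℕ => (2 : ℝ) ^ (-(j : ℤ))) atTop (nhds 0) := by
  have h := tendsto_pow_atTop_nhds_zero_of_lt_one (r := (1 / 2 : ℝ)) (by norm_num) (by norm_num)
  refine h.congr fun j => ?_
  rw [zpow_neg, zpow_natCast, one_div, inv_pow]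

lemma two_zpow_neg_lt_one {j : ℕ} (hj : 1 ≤ j) : (2 : ℝ) ^ (-(j : ℤ)) < 1 :=
  zpow_lt_one_of_neg₀ (by norm_num) (by omega)

lemma tendsto_component {d k0 K : ℝ} {r : ℕ → ℝ} (hr : Tendsto r atTop (nhds 0)) :
    Tendsto (fun j => k0 * (d - r j) / K - (d - r j)) atTop (nhds (k0 * d / K - d)) := by
  have h : Tendsto (fun j => d - r j) atTop (nhds d) := by
    simpa using tendsto_const_nhds.sub hr
  exact ((h.const_mul k0).div_const K).sub h

/-- u_λ − v_λ → d as λ → 0+, and along μ_j, ν_j the solutions v converge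
to k₀d/k₂ − d and k₀d/k* − d respectively. -/
theorem stmt_16 (k1 k2 ks d k0 : ℝ) (hk1 : 0 < k1) (hk12 : k1 < k2)
    (hks1 : (k1 + k2) / 2 < ks) (hks2 : ks < k2) (hd : 1 ≤ d)
    (hk00 : 0 < k0) (hk01 : k0 < k1)
    (u v : ℝ → ℝ)
    (huv : ∀ l : ℝ, 0 < l →
      l * u l + ffun k0 d (u l - v l) = 0 ∧
      l * v l + gfun k0 k1 k2 ks d (v l - u l) = 0)
    (μ ν : ℕ → ℝ)
    (hμ : ∀ j : ℕ, μ j = k2 * (2 : ℝ) ^ (-(j : ℤ)) / (d - (2 : ℝ) ^ (-(j : ℤ))))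
    (hν : ∀ j : ℕ, ν j = (2 : ℝ) ^ (-(j : ℤ)) * |ystar k1 k2 ks| /
        (d - (2 : ℝ) ^ (-(j : ℤ)) * |xstar k1 k2 ks|)) :
    Filter.Tendsto (fun l => u l - v l) (nhdsWithin 0 (Set.Ioi 0)) (nhds d) ∧
    Filter.Tendsto (fun j => v (μ j)) Filter.atTop (nhds (k0 * d / k2 - d)) ∧
    Filter.Tendsto (fun j => v (ν j)) Filter.atTop (nhds (k0 * d / ks - d)) := by
  have hk2 : 0 < k2 := hk1.trans hk12
  have hks : 0 < ks := by linarith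
  have hres : ∀ l : ℝ, 0 < l →
      l * (u l - v l - d + d) + eta k1 k2 ks (u l - v l - d) = 0 ∧
      l * v l + k0 * (u l - v l - d) + l * (u l - v l - d + d) = 0 := by
    intro l hl
    obtain ⟨h1, h2⟩ := huv l hl
    simp only [gfun, ffun, hfun, neg_sub] at h1 h2
    constructor <;> linarith
  refine ⟨?_, ?_, ?_⟩
  · have hlim : Tendsto (fun l : ℝ => d - l * d / ks) (nhdsWithin 0 (Set.Ioi 0)) (nhds d) := by
      have hc : Continuous fun l : ℝ => d - l * d / ks := by fun_prop
      have h := hc.tendsto 0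
      simp only [zero_mul, zero_div, sub_zero] at h
      exact h.mono_left nhdsWithin_le_nhds
    have hneg : ∀ l : ℝ, 0 < l → u l - v l - d < 0 := by
      intro l hl
      by_contra! h
      have h1 := (hres l hl).1
      have h2 := le_eta hk12 hks1 hks2 (u l - v l - d)
      have h3 : 0 ≤ k2 * (u l - v l - d) := mul_nonneg hk2.le h
      have h4 : 0 < l * (u l - v l - d + d) := mul_pos hl (by linarith)
      linarith
    refine tendsto_of_tendsto_of_tendsto_of_le_of_le' hlim tendsto_const_nhds ?_ ?_
    · filter_upwards [self_mem_nhdsWithin] with l hl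
      have hl : 0 < l := hl
      have h1 := (hres l hl).1
      have h0 := hneg l hl
      have h2 := eta_le_of_nonpos hk12 hks1 hks2 h0.le
      have h3 : l * (u l - v l - d) ≤ 0 := by nlinarith
      have h4 : -(u l - v l - d) ≤ l * d / ks := by
        rw [le_div_iff₀ hks]
        linarith
      linarith
    · filter_upwards [self_mem_nhdsWithin] with l hl
      linarith [hneg l hl]
  · refine (tendsto_component tendsto_two_zpow_neg).congr' ?_
    filter_upwards [eventually_ge_atTop 1] with j hj
    have hr : (0 : ℝ) < (2 : ℝ) ^ (-(j : ℤ)) := by positivity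
    have hrd : (2 : ℝ) ^ (-(j : ℤ)) < d := (two_zpow_neg_lt_one hj).trans_le hd
    have hl : 0 < μ j := by
      rw [hμ]
      exact div_pos (by positivity) (by linarith)
    obtain ⟨h1, h2⟩ := hres (μ j) hl
    exact (resolvent_component_eq hk1 hk12 hks1 hks2 hk2 hr hrd (hμ j)
      (eta_neg_two_zpow hk12 hks1 hks2 j) h1 h2).symm
  · have hx := xstar_mem_Ioo hk12 hks1 hks2
    have hx0 : xstar k1 k2 ks < 0 := by linarith [hx.2]
    have hxa : |xstar k1 k2 ks| = -xstar k1 k2 ks := abs_of_neg hx0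
    have hlim : Tendsto (fun j : ℕ => (2 : ℝ) ^ (-(j : ℤ)) * |xstar k1 k2 ks|) atTop
        (nhds 0) := by
      simpa using tendsto_two_zpow_neg.mul_const |xstar k1 k2 ks|
    refine (tendsto_component hlim).congr' ?_
    filter_upwards [eventually_ge_atTop 1] with j hj
    have hp : (0 : ℝ) < (2 : ℝ) ^ (-(j : ℤ)) := by positivity
    have hr : (0 : ℝ) < (2 : ℝ) ^ (-(j : ℤ)) * |xstar k1 k2 ks| :=
      mul_pos hp (abs_pos.mpr hx0.ne)
    have hrd : (2 : ℝ) ^ (-(j : ℤ)) * |xstar k1 k2 ks| < d := by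
      have := two_zpow_neg_lt_one hj
      rw [hxa]
      nlinarith [hx.1]
    have hνj : ν j = ks * ((2 : ℝ) ^ (-(j : ℤ)) * |xstar k1 k2 ks|) /
        (d - (2 : ℝ) ^ (-(j : ℤ)) * |xstar k1 k2 ks|) := by
      rw [hν, ystar, abs_mul, abs_of_pos hks, mul_left_comm]
    have hl : 0 < ν j := by
      rw [hνj]
      exact div_pos (mul_pos hks hr) (by linarith)
    have hη : eta k1 k2 ks (-((2 : ℝ) ^ (-(j : ℤ)) * |xstar k1 k2 ks|)) =
        -(ks * ((2 : ℝ) ^ (-(j : ℤ)) * |xstar k1 k2 ks|)) := by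
      rw [hxa, mul_neg, neg_neg, eta_two_zpow_mul_xstar hk12 hks1 hks2 hj, mul_neg, neg_neg]
    obtain ⟨h1, h2⟩ := hres (ν j) hl
    exact (resolvent_component_eq hk1 hk12 hks1 hks2 hks hr hrd hνj hη h1 h2).symm
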